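/- Let f : ℕ → ℝ be a quasi-polynomial of degree d with f(n) ≥ 0 for all n ∈ ℕ and f not identically zero. Then the summation function Σf : ℕ → ℝ defined by (Σf)(n) = Σ_{i=0}^{n} f(i) is a quasi-polynomial of degree d+1. -/

import Mathlib

/-- `f : ℕ → ℝ` is a quasi-polynomial of degree `d`: there are `N > 0` and constituent
polynomials `c 0, …, c (N-1)`, each of degree `≤ d` and at least one of degree exactly
`d`, with `f n = c (n % N) (n)` for all `n`. -/
def IsQuasiPolynomialDeg (f : ℕ → ℝ) (d : ℕ) : Prop :=
  ∃ (N : ℕ) (c : ℕ → Polynomial ℝ), 0 < N ∧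
    (∀ i < N, (c i).degree ≤ (d : WithBot ℕ)) ∧
    (∃ i < N, (c i).degree = (d : WithBot ℕ)) ∧
    (∀ n : ℕ, f n = (c (n % N)).eval (n : ℝ))

open Polynomial in
/-- A polynomial of degree less than `d` has an antidifference with step `h ≠ 0` of degree at
most `d`. -/
theorem exists_taylor_sub_eq {h : ℝ} (hh : h ≠ 0) (d : ℕ) :
    ∀ p : ℝ[X], p.degree < (d : WithBot ℕ) →
      ∃ P : ℝ[X], P.degree ≤ (d : WithBot ℕ) ∧ taylor h P - P = p := by
  induction d with
  | zero =>
    intro p hp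
    have hp0 : p = 0 := by
      rw [← degree_eq_bot]
      exact Nat.WithBot.lt_zero_iff.mp (by simpa using hp)
    exact ⟨0, by simp, by simp [hp0]⟩
  | succ d ih =>
    intro p hp
    set Q : ℝ[X] := C (p.coeff d / (h * (d + 1))) * X ^ (d + 1) with hQ
    have hQdeg : Q.degree ≤ ((d + 1 : ℕ) : WithBot ℕ) := degree_C_mul_X_pow_le _ _
    have hcoeff : ∀ k, (taylor h Q - Q).coeff k = p.coeff d / (h * (d + 1)) *
        (h ^ (d + 1 - k) * ((d + 1).choose k : ℝ) - if k = d + 1 then 1 else 0) := by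
      intro k
      simp only [hQ, taylor_apply, mul_comp, C_comp, X_pow_comp, coeff_sub, coeff_C_mul,
        coeff_X_add_C_pow, coeff_X_pow]
      ring
    have hd : (d : ℝ) + 1 ≠ 0 := by positivity
    have hrem : (p - (taylor h Q - Q)).degree < (d : WithBot ℕ) := by
      rw [degree_lt_iff_coeff_zero]
      intro k hk
      rw [coeff_sub, hcoeff]
      rcases hk.eq_or_lt with rfl | hk
      · simp
        field_simp
        ring
      · have hpk : p.coeff k = 0 := coeff_eq_zero_of_degree_lt
          (hp.trans_le (by exact_mod_cast hk))
        rcases (Nat.succ_le_of_lt hk).eq_or_lt with rfl | hk'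
        · simp [hpk]
        · have hk'' : k ≠ d + 1 := by grind
          simp [hpk, Nat.choose_eq_zero_of_lt hk', hk'']
    obtain ⟨P, hPdeg, hP⟩ := ih _ hrem
    refine ⟨P + Q, (degree_add_le _ _).trans (max_le (hPdeg.trans ?_) hQdeg), ?_⟩
    · exact_mod_cast Nat.le_succ d
    · rw [map_add]
      linear_combination hP

open Polynomial in
/-- A polynomial of degree `d` has an antidifference with step `h ≠ 0` of degree `d + 1` taking
a prescribed value at a prescribed point. -/
theorem exists_degree_eq_taylor_sub_eq {h : ℝ} (hh : h ≠ 0) {d : ℕ} {p : ℝ[X]}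
    (hp : p.degree = (d : WithBot ℕ)) (x y : ℝ) :
    ∃ P : ℝ[X], P.degree = ((d + 1 : ℕ) : WithBot ℕ) ∧ taylor h P - P = p ∧ P.eval x = y := by
  obtain ⟨P, hPdeg, hP⟩ := exists_taylor_sub_eq hh (d + 1) p
    (by rw [hp]; exact_mod_cast Nat.lt_succ_self d)
  have hP0 : P ≠ 0 := by
    rintro rfl
    simp [← hP] at hp
  have hlt : (d : WithBot ℕ) < P.degree := by
    rw [← hp, ← hP, ← degree_taylor P h]
    exact degree_sub_lt_left (degree_taylor P h) (by simpa using hP0) (by simp)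
  have hdeg : P.degree = ((d + 1 : ℕ) : WithBot ℕ) := by
    refine le_antisymm hPdeg ?_
    rw [degree_eq_natDegree hP0] at hlt ⊢
    exact_mod_cast hlt
  refine ⟨P + C (y - P.eval x), ?_, ?_, by simp⟩
  · rw [degree_add_C, hdeg]
    rw [hdeg]
    exact_mod_cast Nat.succ_pos d
  · rw [map_add, taylor_C, add_sub_add_right_eq_sub, hP]

open Polynomial in
/-- A Taylor shift preserves the top coefficient. -/
theorem coeff_taylor_of_degree_le {p : ℝ[X]} {d : ℕ} (hp : p.degree ≤ (d : WithBot ℕ)) (r : ℝ) :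
    (taylor r p).coeff d = p.coeff d := by
  rcases hp.lt_or_eq with h | h
  · rw [coeff_eq_zero_of_degree_lt h, coeff_eq_zero_of_degree_lt (by rwa [degree_taylor])]
  · rw [← natDegree_eq_of_degree_eq_some h, coeff_taylor_natDegree, leadingCoeff]

open Polynomial Filter Topology in
/-- The top coefficient of a polynomial that is non-negative on an arithmetic progression is
non-negative. -/
theorem coeff_nonneg_of_eval_nonneg {p : ℝ[X]} {d N i : ℕ} (hN : 0 < N)
    (hp : p.degree ≤ (d : WithBot ℕ)) (hpos : ∀ k : ℕ, 0 ≤ p.eval ((i + N * k : ℕ) : ℝ)) :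
    0 ≤ p.coeff d := by
  rcases hp.lt_or_eq with h | h
  · rw [coeff_eq_zero_of_degree_lt h]
  · have ht := div_tendsto_atTop_leadingCoeff_div_of_degree_eq p (X ^ d : ℝ[X]) (by simp [h])
    have hsub : Tendsto (fun k : ℕ => ((i + N * k : ℕ) : ℝ)) atTop atTop :=
      tendsto_natCast_atTop_atTop.comp
        (tendsto_atTop_mono (fun k => (Nat.le_mul_of_pos_left k hN).trans (Nat.le_add_left _ _))
          tendsto_id)
    have := ge_of_tendsto' (ht.comp hsub) (b := 0) fun k => by
      have := hpos k
      simp only [Function.comp_apply, eval_pow, eval_X]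
      positivity
    simpa [leadingCoeff, natDegree_eq_of_degree_eq_some h] using this

open Polynomial in
/-- If `f` is a non-negative, not identically zero quasi-polynomial of degree `d`, then
its summation function `n ↦ Σ_{i=0}^n f(i)` is a quasi-polynomial of degree `d + 1`. -/
theorem sum_quasiPolynomial (f : ℕ → ℝ) (d : ℕ)
    (hf : IsQuasiPolynomialDeg f d) (hpos : ∀ n, 0 ≤ f n) (hne : f ≠ 0) :
    IsQuasiPolynomialDeg (fun n => ∑ i ∈ Finset.range (n + 1), f i) (d + 1) := by
  obtain ⟨N, c, hN, hle, ⟨i₀, hi₀, hdeg⟩, hfc⟩ := hf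
  have hnonneg : ∀ i < N, 0 ≤ (c i).coeff d := fun i hi =>
    coeff_nonneg_of_eval_nonneg (i := i) hN (hle i hi) fun k => by
      simpa [hfc, Nat.mod_eq_of_lt hi] using hpos (i + N * k)
  have hpos₀ : 0 < (c i₀).coeff d :=
    (hnonneg i₀ hi₀).lt_of_ne' (coeff_ne_zero_of_eq_degree hdeg)
  have hN' : (N : ℝ) ≠ 0 := by exact_mod_cast hN.ne'
  let G : ℕ → ℝ[X] := fun r =>
    ∑ j ∈ Finset.range N, taylor ((1 + j : ℕ) : ℝ) (c ((r + 1 + j) % N))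
  have hGdeg : ∀ r < N, (G r).degree = (d : WithBot ℕ) := by
    intro r hr
    refine degree_eq_of_le_of_coeff_ne_zero ?_ (ne_of_gt ?_)
    · refine (degree_sum_le _ _).trans (Finset.sup_le fun j _ => ?_)
      rw [degree_taylor]
      exact hle _ (Nat.mod_lt _ hN)
    · rw [finsetSum_coeff]
      simp only [coeff_taylor_of_degree_le (hle _ (Nat.mod_lt _ hN))]
      refine Finset.sum_pos' (fun j _ => hnonneg _ (Nat.mod_lt _ hN))
        ⟨(i₀ + N - 1 - r) % N, Finset.mem_range.mpr (Nat.mod_lt _ hN), ?_⟩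
      have : r + 1 + (i₀ + N - 1 - r) = i₀ + N := by lia
      rwa [Nat.add_mod_mod, this, Nat.add_mod_right, Nat.mod_eq_of_lt hi₀]
  have hstep : ∀ n, ∑ i ∈ Finset.range (n + N + 1), f i =
      ∑ i ∈ Finset.range (n + 1), f i + (G (n % N)).eval (n : ℝ) := by
    intro n
    rw [add_right_comm, Finset.sum_range_add, eval_finsetSum]
    congr 1
    refine Finset.sum_congr rfl fun j _ => ?_
    rw [hfc, taylor_eval, add_assoc (n % N), Nat.mod_add_mod, ← add_assoc]
    push_cast
    ring_nf
  have hex : ∀ r, ∃ P : ℝ[X], r < N → P.degree = ((d + 1 : ℕ) : WithBot ℕ) ∧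
      taylor (N : ℝ) P - P = G r ∧ P.eval (r : ℝ) = ∑ i ∈ Finset.range (r + 1), f i := by
    intro r
    by_cases hr : r < N
    · obtain ⟨P, hP⟩ := exists_degree_eq_taylor_sub_eq hN' (hGdeg r hr) r
        (∑ i ∈ Finset.range (r + 1), f i)
      exact ⟨P, fun _ => hP⟩
    · exact ⟨0, fun h => absurd h hr⟩
  choose P hP using hex
  refine ⟨N, P, hN, fun i hi => (hP i hi).1.le, ⟨0, hN, (hP 0 hN).1⟩, fun n => ?_⟩
  induction n using Nat.strong_induction_on with
  | _ n ih =>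
    rcases lt_or_ge n N with hn | hn
    · rw [Nat.mod_eq_of_lt hn, (hP n hn).2.2]
    · obtain ⟨m, rfl⟩ := Nat.exists_eq_add_of_le' hn
      have hdiff := congrArg (eval (m : ℝ)) (hP (m % N) (Nat.mod_lt _ hN)).2.1
      rw [eval_sub, taylor_eval] at hdiff
      have hm := ih m (by lia)
      simp only at hm ⊢
      rw [hstep, hm, Nat.add_mod_right, Nat.cast_add, ← hdiff]
      ring
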